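/- arXiv:0705.3555 — 4 statements merged into one kernel-verified Lean document; each statement's English description precedes it below -/
import Mathlib

section
/- Let S be a finite alphabet with |S| = 2^M for an integer M ≥ 1, let K, N, L ≥ 1 be integers and B = K·N. Let 𝒳 be a code whose codewords are B×L arrays with entries in S, and suppose |𝒳| ≥ 2^{R·B·L} for a real number R with 0 < R ≤ M. Group the B rows into K consecutive blocks of N rows each (block k consists of rows N(k-1)+1, …, Nk). Then the block diversity δ of 𝒳, defined as the minimum over distinct codewords X, X' ∈ 𝒳 of the number of row indices b ∈ {1,…,B} such that row b of X differs from row b of X', satisfies δ ≤ N·(1 + ⌊(B/N)·(1 - R/M)⌋). -/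
/-- The pigeonhole form of the Singleton bound: a code of length `n` with more than `|A| ^ t`
codewords has two distinct codewords that differ in at most `n - t` coordinates. -/
theorem exists_ne_card_filter_ne_le {A : Type*} [Fintype A] [DecidableEq A] {n t : ℕ}
    (ht : t ≤ n) (C : Finset (Fin n → A)) (hC : Fintype.card A ^ t < C.card) :
    ∃ X ∈ C, ∃ Y ∈ C, X ≠ Y ∧
      (Finset.univ.filter fun i : Fin n => X i ≠ Y i).card ≤ n - t := by
  obtain ⟨X, hX, Y, hY, hne, hXY⟩ := Finset.exists_ne_map_eq_of_card_lt_of_maps_to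
    (s := C) (t := (Finset.univ : Finset (Fin t → A))) (by simpa using hC)
    (f := fun X i => X (Fin.castLE ht i)) (fun _ _ => by simp)
  refine ⟨X, hX, Y, hY, hne, ?_⟩
  have hsub : (Finset.univ.filter fun i : Fin n => X i ≠ Y i) ⊆
      (Finset.univ.map (Fin.castLEEmb ht))ᶜ := by
    intro i hi
    simp only [Finset.mem_filter, Finset.mem_univ, true_and] at hi
    simp only [Finset.mem_compl, Finset.mem_map, Finset.mem_univ, true_and, not_exists]
    rintro j rfl
    exact hi (congrFun hXY j)
  simpa [Finset.card_compl] using Finset.card_le_card hsub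


/-- **Singleton bound on the block diversity of a coded modulation scheme.**
Let `S` be a finite alphabet with `|S| = 2^M` (`M ≥ 1`), let `K, N, L ≥ 1`,
`B = K * N`, and let `𝒳` be a set of `B × L` arrays over `S` with
`|𝒳| ≥ 2^(R·B·L)` for some real `0 < R ≤ M`.  Then there are two distinct
codewords differing in at most `N * (1 + ⌊(B/N)(1 - R/M)⌋)` rows, i.e. the
block diversity `δ` of `𝒳` satisfies `δ ≤ N * (1 + ⌊(B/N)(1 - R/M)⌋)`. -/
theorem block_diversity_singleton_bound
    (M K N L : ℕ) (hM : 1 ≤ M) (hK : 1 ≤ K) (hN : 1 ≤ N) (hL : 1 ≤ L)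
    (B : ℕ) (hB : B = K * N)
    (S : Type*) [Fintype S] [DecidableEq S] (hS : Fintype.card S = 2 ^ M)
    (R : ℝ) (hR0 : 0 < R) (hRM : R ≤ M)
    (𝒳 : Finset (Fin B → Fin L → S))
    (hcard : (2 : ℝ) ^ (R * B * L) ≤ 𝒳.card) :
    ∃ X ∈ 𝒳, ∃ X' ∈ 𝒳, X ≠ X' ∧
      (Finset.univ.filter fun b : Fin B => X b ≠ X' b).card ≤
        N * (1 + ⌊((B : ℝ) / N) * (1 - R / M)⌋₊) := by
  subst hB
  have hM' : (0 : ℝ) < M := by exact_mod_cast hM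
  have hK' : (0 : ℝ) < K := by exact_mod_cast hK
  have hN' : (0 : ℝ) < N := by exact_mod_cast hN
  have hL' : (0 : ℝ) < L := by exact_mod_cast hL
  have hKN : ((K * N : ℕ) : ℝ) / N = K := by
    push_cast
    field_simp
  rw [hKN]
  set f := ⌊(K : ℝ) * (1 - R / M)⌋₊ with hf
  have hRM' : R / M ≤ 1 := (div_le_one hM').2 hRM
  have hfK : f < K := by
    rw [hf, Nat.floor_lt (mul_nonneg hK'.le (by linarith))]
    have : 0 < (K : ℝ) * (R / M) := by positivity
    linarith
  obtain ⟨t, ht⟩ : ∃ t, K = t + (1 + f) := ⟨K - (1 + f), by omega⟩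
  have htR : (t : ℝ) * M < R * K := by
    have hlt := Nat.lt_floor_add_one ((K : ℝ) * (1 - R / M))
    rw [← hf] at hlt
    have hKt : (K : ℝ) = t + (1 + f) := by exact_mod_cast ht
    have h : (t : ℝ) < R * K / M := by
      have : (K : ℝ) * (1 - R / M) = K - R * K / M := by ring
      linarith
    exact (lt_div_iff₀ hM').1 h
  have hlt : Fintype.card (Fin L → S) ^ (t * N) < 𝒳.card := by
    have hpow : ((Fintype.card (Fin L → S) ^ (t * N) : ℕ) : ℝ) =
        (2 : ℝ) ^ ((t : ℝ) * M * (N * L)) := by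
      rw [Fintype.card_fun, Fintype.card_fin, hS, ← pow_mul, ← pow_mul]
      push_cast
      rw [← Real.rpow_natCast]
      push_cast
      ring_nf
    have hexp : (t : ℝ) * M * (N * L) < R * (K * N : ℕ) * L := by
      have := mul_lt_mul_of_pos_right htR (mul_pos hN' hL')
      push_cast
      linarith
    have : ((Fintype.card (Fin L → S) ^ (t * N) : ℕ) : ℝ) < 𝒳.card :=
      hpow ▸ (Real.rpow_lt_rpow_of_exponent_lt one_lt_two hexp).trans_le hcard
    exact_mod_cast this
  have hle : t * N ≤ K * N := Nat.mul_le_mul_right N (by omega)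
  have hsub : K * N - t * N = N * (1 + f) := by
    rw [← Nat.sub_mul, mul_comm, ht, Nat.add_sub_cancel_left]
  rw [← hsub]
  exact exists_ne_card_filter_ne_le hle 𝒳 hlt
end

section
/- Let m > 0 be real, K, N ≥ 1 integers, B = K·N, and let ε > 0 and θ ∈ [0,1) be real numbers. Define O_ε = { α ∈ ℝ^B : α_b ≥ 0 for all b, and the number of indices k ∈ {1,…,K} such that α_{N(k-1)+n} ≥ 1+ε for all n = 1,…,N is strictly greater than K·θ }. Then lim_{s→∞} −(1/log s)·log ( ∫_{O_ε} s^{−m ∑_{b=1}^B α_b} dα ) = m·(1+ε)·N·(⌊K·θ⌋ + 1), where the integral is with respect to Lebesgue measure on ℝ^B. -/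
open MeasureTheory

/-- The number of groups `k ∈ {1,…,K}` (groups of `N` consecutive coordinates of
`α ∈ ℝ^(K·N)`, group `k` consisting of coordinates `N(k-1)+1, …, Nk`) all of whose
coordinates are at least `c`. -/
noncomputable def deepCount (K N : ℕ) (c : ℝ) (α : Fin (K * N) → ℝ) : ℕ :=
  (Finset.univ.filter fun k : Fin K =>
    ∀ n : Fin N, c ≤ α (finProdFinEquiv (k, n))).card

/-- The box of vectors whose coordinates are all nonnegative, and at least `c` in the groups
indexed by `T`. -/
def deepBox (K N : ℕ) (c : ℝ) (T : Finset (Fin K)) : Set (Fin (K * N) → ℝ) :=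
  Set.univ.pi fun b => Set.Ici (if (finProdFinEquiv.symm b).1 ∈ T then c else 0)

theorem mem_deepBox {K N : ℕ} {c : ℝ} (hc : 0 ≤ c) {T : Finset (Fin K)}
    {α : Fin (K * N) → ℝ} :
    α ∈ deepBox K N c T ↔
      (∀ b, 0 ≤ α b) ∧ ∀ k ∈ T, ∀ n : Fin N, c ≤ α (finProdFinEquiv (k, n)) := by
  simp only [deepBox, Set.mem_univ_pi, Set.mem_Ici]
  constructor
  · intro h
    refine ⟨fun b => le_trans ?_ (h b), fun k hk n => ?_⟩
    · split_ifs <;> simp [hc]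
    · simpa [hk, -finProdFinEquiv_apply_val] using h (finProdFinEquiv (k, n))
  · rintro ⟨h0, h1⟩ b
    obtain ⟨⟨k, n⟩, rfl⟩ := finProdFinEquiv.surjective b
    rw [Equiv.symm_apply_apply]
    split_ifs with hk
    · exact h1 k hk n
    · exact h0 _

theorem setOf_le_deepCount_eq_iUnion {K N : ℕ} {c : ℝ} (hc : 0 ≤ c) (j : ℕ) :
    {α : Fin (K * N) → ℝ | (∀ b, 0 ≤ α b) ∧ j ≤ deepCount K N c α} =
      ⋃ T : {T : Finset (Fin K) // T.card = j}, deepBox K N c T.1 := by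
  ext α
  simp only [Set.mem_ofPred_eq, Set.mem_iUnion, mem_deepBox hc]
  constructor
  · rintro ⟨h0, hj⟩
    obtain ⟨T, hT, hTj⟩ := Finset.exists_subset_card_eq hj
    exact ⟨⟨T, hTj⟩, h0, fun k hk => (Finset.mem_filter.1 (hT hk)).2⟩
  · rintro ⟨⟨T, rfl⟩, h0, h1⟩
    exact ⟨h0, Finset.card_le_card fun k hk =>
      Finset.mem_filter.2 ⟨Finset.mem_univ k, h1 k hk⟩⟩

theorem exp_mul_sum_integrableOn_pi_Ici {ι : Type*} [Fintype ι] {a : ℝ} (ha : 0 < a)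
    (d : ι → ℝ) :
    IntegrableOn (fun α : ι → ℝ => Real.exp (-a * ∑ b, α b))
      (Set.univ.pi fun b => Set.Ici (d b)) := by
  simp_rw [Finset.mul_sum, Real.exp_sum]
  rw [IntegrableOn, volume_pi, Measure.restrict_pi_pi]
  refine Integrable.fintype_prod (f := fun _ x => Real.exp (-a * x)) fun b => ?_
  exact (integrableOn_Ici_iff_integrableOn_Ioi).2 (integrableOn_exp_mul_Ioi (by linarith) _)

theorem setIntegral_exp_mul_sum_pi_Ici {ι : Type*} [Fintype ι] {a : ℝ} (ha : 0 < a)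
    (d : ι → ℝ) :
    ∫ α in Set.univ.pi fun b => Set.Ici (d b), Real.exp (-a * ∑ b, α b) =
      Real.exp (-a * ∑ b, d b) / a ^ Fintype.card ι := by
  simp_rw [Finset.mul_sum, Real.exp_sum]
  rw [volume_pi, Measure.restrict_pi_pi,
    integral_fintype_prod_eq_prod (fun _ x => Real.exp (-a * x))]
  simp_rw [integral_Ici_eq_integral_Ioi, integral_exp_mul_Ioi (neg_lt_zero.2 ha), neg_div_neg_eq]
  rw [Finset.prod_div_distrib, Finset.prod_const, Finset.card_univ]

theorem setIntegral_exp_mul_sum_deepBox {K N : ℕ} {c a : ℝ} (ha : 0 < a)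
    (T : Finset (Fin K)) :
    ∫ α in deepBox K N c T, Real.exp (-a * ∑ b, α b) =
      Real.exp (-a * (c * N * T.card)) / a ^ (K * N) := by
  rw [deepBox, setIntegral_exp_mul_sum_pi_Ici ha, Fintype.card_fin,
    ← finProdFinEquiv.sum_comp, Fintype.sum_prod_type]
  simp only [Equiv.symm_apply_apply, Finset.sum_const, Finset.card_univ, Fintype.card_fin,
    nsmul_eq_mul, mul_ite, mul_zero, Finset.sum_ite_mem, Finset.univ_inter]
  congr 3
  ring

theorem le_setIntegral_deepCount {K N j : ℕ} {c a : ℝ} (hc : 0 ≤ c) (ha : 0 < a)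
    (hj : j ≤ K) :
    Real.exp (-a * (c * N * j)) / a ^ (K * N) ≤
      ∫ α in {α : Fin (K * N) → ℝ | (∀ b, 0 ≤ α b) ∧ j ≤ deepCount K N c α},
        Real.exp (-a * ∑ b, α b) := by
  obtain ⟨T, -, rfl⟩ := Finset.exists_subset_card_eq
    (s := (Finset.univ : Finset (Fin K))) (n := j) (by simpa using hj)
  rw [← setIntegral_exp_mul_sum_deepBox ha T, setOf_le_deepCount_eq_iUnion hc]
  refine setIntegral_mono_set ?_ (.of_forall fun _ => (Real.exp_pos _).le)
    (Set.subset_iUnion (fun T' : {T' : Finset (Fin K) // T'.card = T.card} =>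
      deepBox K N c T'.1) ⟨T, rfl⟩).eventuallyLE
  exact integrableOn_finite_iUnion.2 fun T => exp_mul_sum_integrableOn_pi_Ici ha _

theorem setIntegral_deepCount_le {K N j : ℕ} {c a : ℝ} (hc : 0 ≤ c) (ha : 0 < a) :
    ∫ α in {α : Fin (K * N) → ℝ | (∀ b, 0 ≤ α b) ∧ j ≤ deepCount K N c α},
        Real.exp (-a * ∑ b, α b) ≤
      K.choose j * (Real.exp (-a * (c * N * j)) / a ^ (K * N)) := by
  rw [setOf_le_deepCount_eq_iUnion hc]
  have hint : ∀ T ∈ (Finset.univ : Finset {T : Finset (Fin K) // T.card = j}),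
      Integrable (fun α : Fin (K * N) → ℝ => Real.exp (-a * ∑ b, α b))
        (volume.restrict (deepBox K N c T.1)) :=
    fun T _ => exp_mul_sum_integrableOn_pi_Ici ha _
  calc
    _ ≤ ∫ α, Real.exp (-a * ∑ b, α b)
          ∂(∑ T : {T : Finset (Fin K) // T.card = j}, volume.restrict (deepBox K N c T.1)) := by
      refine integral_mono_measure ?_ (.of_forall fun _ => (Real.exp_pos _).le)
        (integrable_finsetSum_measure.2 hint)
      rw [← Measure.sum_fintype]
      exact Measure.restrict_iUnion_le
    _ = ∑ T : {T : Finset (Fin K) // T.card = j},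
          Real.exp (-a * (c * N * j)) / a ^ (K * N) := by
      rw [integral_finsetSum_measure hint]
      exact Finset.sum_congr rfl fun T _ => by rw [setIntegral_exp_mul_sum_deepBox ha, T.2]
    _ = _ := by simp

/-- A function of order `(m * log s) ^ (-B) * s ^ (-m * p)`, up to constants, has SNR exponent
`m * p`. -/
theorem tendsto_neg_log_div_log_of_bounds {m p C : ℝ} (hm : 0 < m) (hC : 0 < C) (B : ℕ)
    {I : ℝ → ℝ}
    (hlow : ∀ s, 1 < s →
      Real.exp (-(m * Real.log s) * p) / (m * Real.log s) ^ B ≤ I s)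
    (hupp : ∀ s, 1 < s →
      I s ≤ C * (Real.exp (-(m * Real.log s) * p) / (m * Real.log s) ^ B)) :
    Filter.Tendsto (fun s => -(1 / Real.log s) * Real.log (I s)) Filter.atTop
      (nhds (m * p)) := by
  have hlog : Filter.Tendsto (fun s => m * Real.log s) Filter.atTop Filter.atTop :=
    Real.tendsto_log_atTop.const_mul_atTop hm
  have hup : Filter.Tendsto (fun s => m * p +
      m * B * (Real.log (m * Real.log s) / (m * Real.log s))) Filter.atTop (nhds (m * p)) := by
    simpa using ((Real.isLittleO_log_id_atTop.tendsto_div_nhds_zero.comp hlog).const_mul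
      (m * B)).const_add (m * p)
  have hlo : Filter.Tendsto (fun s => m * p +
      m * B * (Real.log (m * Real.log s) / (m * Real.log s)) - Real.log C / Real.log s)
      Filter.atTop (nhds (m * p)) := by
    simpa using hup.sub (Real.tendsto_log_atTop.const_div_atTop (Real.log C))
  refine tendsto_of_tendsto_of_tendsto_of_le_of_le' hlo hup ?_ ?_ <;>
    filter_upwards [Filter.eventually_gt_atTop 1] with s hs
  all_goals
    have hL : 0 < Real.log s := Real.log_pos hs
    have hmL : 0 < m * Real.log s := mul_pos hm hL
    have hE : 0 < Real.exp (-(m * Real.log s) * p) / (m * Real.log s) ^ B := by positivity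
    have hlogE : Real.log (Real.exp (-(m * Real.log s) * p) / (m * Real.log s) ^ B) =
        -(m * Real.log s) * p - B * Real.log (m * Real.log s) := by
      rw [Real.log_div (Real.exp_ne_zero _) (by positivity), Real.log_exp, Real.log_pow]
  · have h := Real.log_le_log (hE.trans_le (hlow s hs)) (hupp s hs)
    rw [Real.log_mul hC.ne' hE.ne', hlogE] at h
    calc
      _ = -(1 / Real.log s) *
          (Real.log C + (-(m * Real.log s) * p - B * Real.log (m * Real.log s))) := by
        field_simp
        ring
      _ ≤ _ := mul_le_mul_of_nonpos_left h (by simpa using hL.le)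
  · have h := Real.log_le_log hE (hlow s hs)
    rw [hlogE] at h
    calc
      _ ≤ -(1 / Real.log s) *
          (-(m * Real.log s) * p - B * Real.log (m * Real.log s)) :=
        mul_le_mul_of_nonpos_left h (by simpa using hL.le)
      _ = _ := by
        field_simp
        ring

/-- **SNR exponent of the outage integral.**  For `m > 0`, `B = K·N`, `ε > 0`
and `θ ∈ [0,1)`,
`lim_{s→∞} -(1/log s)·log ∫_{O_ε} s^{-m ∑_b α_b} dα = m·(1+ε)·N·(⌊K·θ⌋+1)`,
where `O_ε = {α ⪰ 0 : #{k : α_{N(k-1)+n} ≥ 1+ε for all n} > K·θ}` and the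
integral is with respect to Lebesgue measure on `ℝ^B`. -/
theorem outage_integral_snr_exponent
    (m : ℝ) (hm : 0 < m) (K N : ℕ) (hK : 1 ≤ K) (hN : 1 ≤ N)
    (ε θ : ℝ) (hε : 0 < ε) (hθ0 : 0 ≤ θ) (hθ1 : θ < 1) :
    Filter.Tendsto (fun s : ℝ =>
        -(1 / Real.log s) * Real.log
          (∫ α in {α : Fin (K * N) → ℝ |
              (∀ b, 0 ≤ α b) ∧ (K : ℝ) * θ < (deepCount K N (1 + ε) α : ℝ)},
            s ^ (-(m * ∑ b, α b))))
      Filter.atTop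
      (nhds (m * (1 + ε) * N * (⌊(K : ℝ) * θ⌋₊ + 1))) := by
  have hK0 : (0 : ℝ) < K := by exact_mod_cast hK
  have hc : 0 ≤ 1 + ε := by linarith
  have hKθ : 0 ≤ (K : ℝ) * θ := by positivity
  have hj : ⌊(K : ℝ) * θ⌋₊ + 1 ≤ K := Nat.succ_le_of_lt <|
    (Nat.floor_lt hKθ).2 (mul_lt_of_lt_one_right hK0 hθ1)
  have hpow : ∀ s : ℝ, 1 < s → ∀ α : Fin (K * N) → ℝ,
      s ^ (-(m * ∑ b, α b)) = Real.exp (-(m * Real.log s) * ∑ b, α b) := fun s hs α => by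
    rw [Real.rpow_def_of_pos (by linarith)]
    ring_nf
  simp_rw [← Nat.floor_lt hKθ, ← Nat.succ_le_iff, Nat.succ_eq_add_one]
  have hlim : m * (1 + ε) * N * (⌊(K : ℝ) * θ⌋₊ + 1) =
      m * ((1 + ε) * N * (⌊(K : ℝ) * θ⌋₊ + 1 : ℕ)) := by
    push_cast
    ring
  rw [hlim]
  refine tendsto_neg_log_div_log_of_bounds hm
    (C := K.choose (⌊(K : ℝ) * θ⌋₊ + 1)) (by exact_mod_cast Nat.choose_pos hj) (K * N) ?_ ?_
  all_goals
    intro s hs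
    simp_rw [hpow s hs]
  · exact le_setIntegral_deepCount hc (mul_pos hm (Real.log_pos hs)) hj
  · exact setIntegral_deepCount_le hc (mul_pos hm (Real.log_pos hs))
end

section
/- Let K, N ≥ 1 be integers, B = K·N, and let m > 0, c ≥ 0, δ ∈ (0,1), θ ∈ (0,1] be real numbers. For α ∈ ℝ^B with nonnegative entries let J(α) denote the number of indices k ∈ {1,…,K} such that α_{N(k-1)+n} ≥ 1−δ for all n = 1,…,N. Then the infimum of m·∑_{b=1}^B α_b + c·(K·θ − J(α)) over all α ∈ ℝ^B with nonnegative entries satisfying J(α) < K·θ equals min_{0 ≤ j ≤ ⌈Kθ⌉−1} [ j·m·N·(1−δ) + c·(K·θ − j) ], the minimum being over integers j. -/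
theorem sum_eq_sum_groups (K N : ℕ) (α : Fin (K * N) → ℝ) :
    ∑ b, α b = ∑ k : Fin K, ∑ n : Fin N, α (finProdFinEquiv (k, n)) := by
  rw [← Fintype.sum_prod_type', ← finProdFinEquiv.sum_comp]

theorem deepCount_mul_le_sum (K N : ℕ) (c : ℝ) (α : Fin (K * N) → ℝ) (hα : ∀ b, 0 ≤ α b) :
    (deepCount K N c α : ℝ) * (N * c) ≤ ∑ b, α b := by
  rw [sum_eq_sum_groups, deepCount, ← nsmul_eq_mul, ← Finset.sum_const]
  calc _ ≤ ∑ k : Fin K with ∀ n : Fin N, c ≤ α (finProdFinEquiv (k, n)),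
        ∑ n : Fin N, α (finProdFinEquiv (k, n)) := by
        refine Finset.sum_le_sum fun k hk => ?_
        have h := Finset.sum_le_sum fun n (_ : n ∈ Finset.univ) => (Finset.mem_filter.mp hk).2 n
        simpa using h
    _ ≤ _ := Finset.sum_le_sum_of_subset_of_nonneg (Finset.filter_subset _ _)
        fun k _ _ => Finset.sum_nonneg fun n _ => hα _

/-- The vector equal to `c` on the first `j` groups and `0` on the others. -/
noncomputable def firstGroups (K N : ℕ) (c : ℝ) (j : ℕ) (b : Fin (K * N)) : ℝ :=
  if ((finProdFinEquiv.symm b).1 : ℕ) < j then c else 0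

theorem card_filter_val_lt {K j : ℕ} (hj : j ≤ K) :
    (Finset.univ.filter fun k : Fin K => (k : ℕ) < j).card = j := by
  rw [Fin.card_filter_val_lt, min_eq_right hj]

theorem deepCount_firstGroups {K N : ℕ} (hN : 1 ≤ N) {c : ℝ} (hc : 0 < c) {j : ℕ}
    (hj : j ≤ K) : deepCount K N c (firstGroups K N c j) = j := by
  have : Nonempty (Fin N) := ⟨⟨0, hN⟩⟩
  conv_rhs => rw [← card_filter_val_lt hj]
  unfold deepCount firstGroups
  congr 1
  ext k
  simp only [Equiv.symm_apply_apply, forall_const, Finset.mem_filter, Finset.mem_univ, true_and]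
  split_ifs with h <;> simp [h, hc]

theorem sum_firstGroups {K N : ℕ} (c : ℝ) {j : ℕ} (hj : j ≤ K) :
    ∑ b, firstGroups K N c j b = j * (N * c) := by
  rw [sum_eq_sum_groups]
  simp only [firstGroups, Equiv.symm_apply_apply, Finset.sum_const, Finset.card_univ,
    Fintype.card_fin, nsmul_eq_mul, mul_ite, mul_zero]
  rw [← Finset.sum_filter, Finset.sum_const, card_filter_val_lt hj, nsmul_eq_mul]

/-- **Finite-length term of the random coding exponent.**  For `B = K·N`, `m > 0`,
`c ≥ 0`, `δ ∈ (0,1)` and `θ ∈ (0,1]`, the infimum of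
`m·∑_b α_b + c·(K·θ - J(α))` over all `α ⪰ 0` with `J(α) < K·θ` equals
`min_{0 ≤ j ≤ ⌈Kθ⌉-1} [ j·m·N·(1-δ) + c·(K·θ - j) ]`. -/
theorem finite_length_exponent_inf
    (K N : ℕ) (hK : 1 ≤ K) (hN : 1 ≤ N)
    (m c δ θ : ℝ) (hm : 0 < m) (hc : 0 ≤ c)
    (hδ0 : 0 < δ) (hδ1 : δ < 1) (hθ0 : 0 < θ) (hθ1 : θ ≤ 1) :
    sInf ((fun α : Fin (K * N) → ℝ =>
          m * ∑ b, α b + c * ((K : ℝ) * θ - (deepCount K N (1 - δ) α : ℝ))) ''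
        {α | (∀ b, 0 ≤ α b) ∧ (deepCount K N (1 - δ) α : ℝ) < (K : ℝ) * θ}) =
      (Finset.range ⌈(K : ℝ) * θ⌉₊).inf'
        (Finset.nonempty_range_iff.mpr
          (by
            have hKpos : (0 : ℝ) < (K : ℝ) := by exact_mod_cast Nat.lt_of_lt_of_le Nat.zero_lt_one hK
            simp only [ne_eq, Nat.ceil_eq_zero, not_le]
            exact mul_pos hKpos hθ0))
        (fun j => (j : ℝ) * (m * N * (1 - δ)) + c * ((K : ℝ) * θ - j)) := by
  have hδ : 0 < 1 - δ := sub_pos.mpr hδ1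
  refine IsLeast.csInf_eq ⟨?_, ?_⟩
  · obtain ⟨j, hj, h⟩ := Finset.exists_mem_eq_inf' (s := Finset.range ⌈(K : ℝ) * θ⌉₊)
      (Finset.nonempty_range_iff.mpr (by
        simpa using mul_pos (Nat.cast_pos.mpr hK : (0 : ℝ) < K) hθ0))
      (fun j : ℕ => (j : ℝ) * (m * N * (1 - δ)) + c * ((K : ℝ) * θ - j))
    have hjθ : (j : ℝ) < K * θ := Nat.lt_ceil.mp (Finset.mem_range.mp hj)
    have hjK : j ≤ K := by
      have : (j : ℝ) ≤ K := hjθ.le.trans (mul_le_of_le_one_right K.cast_nonneg hθ1)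
      exact_mod_cast this
    rw [h]
    refine ⟨firstGroups K N (1 - δ) j, ⟨fun b => ?_, ?_⟩, ?_⟩
    · unfold firstGroups
      split_ifs <;> simp [hδ1.le]
    · rwa [deepCount_firstGroups hN hδ hjK]
    · simp only [deepCount_firstGroups hN hδ hjK, sum_firstGroups _ hjK]
      ring
  · rintro _ ⟨α, ⟨hα, hJ⟩, rfl⟩
    refine (Finset.inf'_le _ (Finset.mem_range.mpr (Nat.lt_ceil.mpr hJ))).trans ?_
    have h := mul_le_mul_of_nonneg_left (deepCount_mul_le_sum K N (1 - δ) α hα) hm.le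
    dsimp only
    linarith
end

section
/- Let N ≥ 1 and P ≥ 1 be integers, let v_1, …, v_P ∈ ℝ^N be vectors all of whose components are strictly positive, and let α ∈ ℝ^N. For s > 1 define f(s) = log₂( 1 + ∑_{i=1}^P exp( −(1/4) ∑_{n=1}^N s^{1−α_n} · v_{i,n} ) ). If α_n > 1 for all n = 1, …, N, then lim_{s→∞} f(s) = log₂(1 + P); if α_n < 1 for some n, then lim_{s→∞} f(s) = 0. -/
/-- If every summand tends to `c`, then `logb 2 (1 + ∑ i, g i s)` tends to `logb 2 (1 + P * c)`. -/
theorem tendsto_logb_one_add_sum {P : ℕ} {l : Filter ℝ} {g : Fin P → ℝ → ℝ} {c : ℝ} (hc : 0 ≤ c)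
    (hg : ∀ i, Filter.Tendsto (g i) l (nhds c)) :
    Filter.Tendsto (fun s => Real.logb 2 (1 + ∑ i, g i s)) l (nhds (Real.logb 2 (1 + P * c))) := by
  have hsum : Filter.Tendsto (fun s => 1 + ∑ i, g i s) l (nhds (1 + P * c)) := by
    simpa using (tendsto_finsetSum Finset.univ fun i _ => hg i).const_add 1
  have hne : (1 + P * c : ℝ) ≠ 0 := by positivity
  exact (hsum.log hne).div_const _


/-- **Large-SNR limit of the log-sum-exp term of the mutual information.**
Let `v_1, …, v_P ∈ ℝ^N` have all components strictly positive and let `α ∈ ℝ^N`.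
For `f(s) = log₂(1 + ∑_i exp(-(1/4)·∑_n s^(1-α_n)·v_{i,n}))`:
if `α_n > 1` for all `n` then `f(s) → log₂(1+P)` as `s → ∞`, while if `α_n < 1`
for some `n` then `f(s) → 0` as `s → ∞`. -/
theorem logsumexp_limit
    (N P : ℕ) (hN : 1 ≤ N) (hP : 1 ≤ P)
    (v : Fin P → Fin N → ℝ) (hv : ∀ i n, 0 < v i n) (α : Fin N → ℝ) :
    ((∀ n, 1 < α n) →
      Filter.Tendsto (fun s : ℝ =>
          Real.logb 2 (1 + ∑ i, Real.exp (-(1 / 4) * ∑ n, s ^ (1 - α n) * v i n)))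
        Filter.atTop (nhds (Real.logb 2 (1 + P)))) ∧
    ((∃ n, α n < 1) →
      Filter.Tendsto (fun s : ℝ =>
          Real.logb 2 (1 + ∑ i, Real.exp (-(1 / 4) * ∑ n, s ^ (1 - α n) * v i n)))
        Filter.atTop (nhds 0)) := by
  constructor
  · intro hα
    have key := tendsto_logb_one_add_sum (P := P) (l := Filter.atTop) (c := 1) zero_le_one
      (g := fun i s => Real.exp (-(1 / 4) * ∑ n, s ^ (1 - α n) * v i n)) fun i => by
        have hpow (n : Fin N) : Filter.Tendsto (fun s : ℝ => s ^ (1 - α n) * v i n)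
            Filter.atTop (nhds 0) := by
          have h := tendsto_rpow_neg_atTop (y := α n - 1) (by linarith [hα n])
          simpa using h.mul_const (v i n)
        have hsum := (tendsto_finsetSum Finset.univ fun n _ => hpow n).const_mul (-(1 / 4) : ℝ)
        simpa [Function.comp_def] using (Real.continuous_exp.tendsto _).comp hsum
    simpa using key
  · rintro ⟨m, hm⟩
    have key := tendsto_logb_one_add_sum (P := P) (l := Filter.atTop) (c := 0) le_rfl
      (g := fun i s => Real.exp (-(1 / 4) * ∑ n, s ^ (1 - α n) * v i n)) fun i => by
        have hterm : Filter.Tendsto (fun s : ℝ => s ^ (1 - α m) * v i m)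
            Filter.atTop Filter.atTop :=
          (tendsto_rpow_atTop (by linarith)).atTop_mul_const (hv i m)
        have hsum : Filter.Tendsto (fun s : ℝ => ∑ n, s ^ (1 - α n) * v i n)
            Filter.atTop Filter.atTop := by
          refine Filter.tendsto_atTop_mono' _ ?_ hterm
          filter_upwards [Filter.eventually_ge_atTop 0] with s hs
          exact Finset.single_le_sum (f := fun n => s ^ (1 - α n) * v i n)
            (fun n _ => mul_nonneg (Real.rpow_nonneg hs _) (hv i n).le) (Finset.mem_univ m)
        exact Real.tendsto_exp_atBot.comp (hsum.const_mul_atTop_of_neg (by norm_num))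
    simpa using key
end
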